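/- Let X be a compact subset of a real Hilbert space H with the inherited metric d = ‖· − ·‖_H, and let μ be a finite Borel regular measure on X with closed support equal to X and 0 < μ(X) < ∞. Assume (X, d) is Kał-doubling. If the canonical map ι_d : X → L²(μ), x ↦ (z ↦ ‖x − z‖_H), is bi-Lipschitz, then there exist N ∈ ℕ and a bi-Lipschitz embedding of X into ℝ^N. -/

import Mathlib

open MeasureTheory

/-- A metric space `X` is Kał-doubling (for exponent `2`): there is `C : ℝ → ℝ` with
`r² C(r) → 0` as `r → 0⁺` such that every closed ball `B(x, r)` can be covered by at
most `C(r)` closed balls of radius `r/2` with centers in `B(x, r)`. -/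
def KalDoubling (X : Type*) [MetricSpace X] : Prop :=
  ∃ C : ℝ → ℝ,
    Filter.Tendsto (fun r : ℝ => r ^ 2 * C r) (nhdsWithin 0 (Set.Ioi 0)) (nhds 0) ∧
    ∀ (x : X) (r : ℝ), 0 < r → ∃ t : Finset X,
      (↑t : Set X) ⊆ Metric.closedBall x r ∧ (t.card : ℝ) ≤ C r ∧
      Metric.closedBall x r ⊆ ⋃ c ∈ t, Metric.closedBall c (r / 2)

open Filter Topology

/-- `SeparatedOn U` says that finitely many real Lipschitz functions suffice to bound the
distance of every pair in `U` from above, up to a constant. -/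
def SeparatedOn {X : Type*} [PseudoMetricSpace X] (U : Set (X × X)) : Prop :=
  ∃ s : Set (X → ℝ), s.Finite ∧ (∀ g ∈ s, ∃ K, LipschitzWith K g) ∧
    ∃ c > 0, ∀ p ∈ U, ∃ g ∈ s, c * dist p.1 p.2 ≤ |g p.1 - g p.2|

namespace SeparatedOn

variable {X : Type*} [PseudoMetricSpace X] {U V : Set (X × X)}

lemma empty : SeparatedOn (∅ : Set (X × X)) :=
  ⟨∅, Set.finite_empty, by simp, 1, one_pos, by simp⟩

lemma mono (hUV : U ⊆ V) (hV : SeparatedOn V) : SeparatedOn U := by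
  obtain ⟨s, hs, hL, c, hc, h⟩ := hV
  exact ⟨s, hs, hL, c, hc, fun p hp => h p (hUV hp)⟩

lemma union (hU : SeparatedOn U) (hV : SeparatedOn V) : SeparatedOn (U ∪ V) := by
  obtain ⟨s, hs, hL, c, hc, h⟩ := hU
  obtain ⟨t, ht, hL', c', hc', h'⟩ := hV
  refine ⟨s ∪ t, hs.union ht, ?_, min c c', lt_min hc hc', ?_⟩
  · rintro g (hg | hg)
    exacts [hL g hg, hL' g hg]
  · rintro p (hp | hp)
    · obtain ⟨g, hg, hle⟩ := h p hp
      refine ⟨g, Or.inl hg, le_trans ?_ hle⟩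
      gcongr
      exact min_le_left _ _
    · obtain ⟨g, hg, hle⟩ := h' p hp
      refine ⟨g, Or.inr hg, le_trans ?_ hle⟩
      gcongr
      exact min_le_right _ _

/-- Off the diagonal, the distance to the first point separates nearby pairs. -/
lemma exists_mem_nhds_of_dist_pos {x y : X} (hxy : 0 < dist x y) :
    ∃ U ∈ 𝓝 (x, y), SeparatedOn U := by
  have hev : ∀ᶠ p : X × X in 𝓝 (x, y),
      (1 / 4 : ℝ) * dist p.1 p.2 < |dist p.1 x - dist p.2 x| := by
    apply (continuous_const.mul (continuous_fst.dist continuous_snd)).continuousAt.eventually_lt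
      ((continuous_fst.dist continuous_const).sub
        (continuous_snd.dist continuous_const)).abs.continuousAt
    change 1 / 4 * dist x y < |dist x x - dist y x|
    rw [dist_self, zero_sub, abs_neg, dist_comm y x, abs_of_pos hxy]
    linarith
  refine ⟨_, hev, {fun p => dist p x}, Set.finite_singleton _, ?_, 1 / 4, by norm_num, ?_⟩
  · rintro g rfl
    exact ⟨1, LipschitzWith.dist_left x⟩
  · intro p hp
    exact ⟨_, rfl, le_of_lt hp⟩

/-- On a compact space, separation is a local property of pairs. -/
lemma univ_of_forall_nhds [CompactSpace X] (h : ∀ p : X × X, ∃ U ∈ 𝓝 p, SeparatedOn U) :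
    SeparatedOn (Set.univ : Set (X × X)) := by
  refine isCompact_univ.induction_on empty (fun _ _ => mono) (fun _ _ => union) fun p _ => ?_
  simpa only [nhdsWithin_univ] using h p

/-- A finite separating family of Lipschitz functions gives a bi-Lipschitz Euclidean embedding. -/
lemma exists_biLipschitz (h : SeparatedOn (Set.univ : Set (X × X))) :
    ∃ (N : ℕ) (f : X → EuclideanSpace ℝ (Fin N)) (c e : ℝ), 0 < c ∧ c ≤ e ∧
      ∀ x y : X, c * dist x y ≤ dist (f x) (f y) ∧ dist (f x) (f y) ≤ e * dist x y := by
  obtain ⟨s, hs, hL, c, hc, h⟩ := h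
  obtain ⟨N, g, rfl⟩ : ∃ (N : ℕ) (g : Fin N → X → ℝ), Set.range g = s := by
    obtain ⟨N, g, -, hg⟩ := hs.fin_param
    exact ⟨N, g, hg⟩
  choose K hK using fun i => hL (g i) ⟨i, rfl⟩
  have hlip : LipschitzWith (∑ i, K i) (fun x i => g i x) :=
    LipschitzWith.of_dist_le_mul fun x y => by
      rw [dist_pi_le_iff (by positivity)]
      intro i
      refine ((hK i).dist_le_mul x y).trans ?_
      gcongr
      exact Finset.single_le_sum (f := K) (fun _ _ => zero_le) (Finset.mem_univ i)
  obtain ⟨L, hf⟩ : ∃ L, LipschitzWith L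
      (fun x => (WithLp.toLp 2 fun i => g i x : EuclideanSpace ℝ (Fin N))) :=
    ⟨_, (PiLp.lipschitzWith_toLp 2 (fun _ : Fin N => ℝ)).comp hlip⟩
  refine ⟨N, fun x => WithLp.toLp 2 fun i => g i x, c, max c L, hc, le_max_left _ _,
    fun x y => ⟨?_, (hf.dist_le_mul x y).trans ?_⟩⟩
  · obtain ⟨_, ⟨i, rfl⟩, hi⟩ := h (x, y) trivial
    refine hi.trans ?_
    rw [dist_eq_norm]
    exact PiLp.norm_apply_le
      ((WithLp.toLp 2 fun i => g i x : EuclideanSpace ℝ (Fin N)) - WithLp.toLp 2 fun i => g i y) i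
  · gcongr
    exact le_max_right _ _

end SeparatedOn

section InnerProductSpace

variable {H : Type*} [NormedAddCommGroup H] [InnerProductSpace ℝ H]

lemma norm_sub_sub_norm_sub_mul_add (x y z : H) :
    (‖x - z‖ - ‖y - z‖) * (‖x - z‖ + ‖y - z‖) =
      inner ℝ (x - y) (x - z) + inner ℝ (x - y) (y - z) := by
  rw [← sub_sub_sub_cancel_right x y z, inner_sub_left (x - z), inner_sub_left (x - z),
    real_inner_self_eq_norm_sq, real_inner_self_eq_norm_sq, real_inner_comm (x - z) (y - z)]
  ring

/-- Difference quotients of distance functions along a sequence of secants `p n - q n` shrinking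
to `x` tend to zero away from `x`, if the secant directions are asymptotically orthogonal to
`x - z`. -/
lemma tendsto_norm_sub_sub_norm_sub_div {p q : ℕ → H} {x z : H} (hz : z ≠ x)
    (hp : Tendsto p atTop (𝓝 x)) (hq : Tendsto q atTop (𝓝 x))
    (hv : Tendsto (fun n => inner ℝ (‖p n - q n‖⁻¹ • (p n - q n)) (x - z)) atTop (𝓝 0)) :
    Tendsto (fun n => (‖p n - z‖ - ‖q n - z‖) / ‖p n - q n‖) atTop (𝓝 0) := by
  set v : ℕ → H := fun n => ‖p n - q n‖⁻¹ • (p n - q n) with hvdef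
  have hv1 (n) : ‖v n‖ ≤ 1 := by
    simp only [hvdef, norm_smul, norm_inv, norm_norm]
    exact inv_mul_le_one
  have key {r : ℕ → H} (hr : Tendsto r atTop (𝓝 x)) :
      Tendsto (fun n => inner ℝ (v n) (r n - z)) atTop (𝓝 0) := by
    have h0 : Tendsto (fun n => inner ℝ (v n) (r n - x)) atTop (𝓝 0) := by
      refine squeeze_zero_norm (fun n => ?_) (tendsto_iff_norm_sub_tendsto_zero.1 hr)
      exact (norm_inner_le_norm _ _).trans (mul_le_of_le_one_left (norm_nonneg _) (hv1 n))
    have := h0.add hv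
    rw [add_zero] at this
    refine this.congr fun n => ?_
    rw [← inner_add_right, sub_add_sub_cancel]
  have hpz := (hp.sub_const z).norm
  have hqz := (hq.sub_const z).norm
  have hxz : 0 < ‖x - z‖ := norm_pos_iff.2 (sub_ne_zero.2 hz.symm)
  have hlim := ((key hp).add (key hq)).div (hpz.add hqz) (by positivity)
  rw [add_zero, zero_div] at hlim
  refine hlim.congr' ?_
  filter_upwards [hpz.eventually (lt_mem_nhds hxz)] with n hn
  have hne : ‖p n - z‖ + ‖q n - z‖ ≠ 0 := by positivity
  have := norm_sub_sub_norm_sub_mul_add (p n) (q n) z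
  simp only [hvdef, inner_smul_left, conj_trivial, ← mul_add, ← this, Pi.div_apply]
  field_simp

lemma tendsto_inner_of_denseRange {v : ℕ → H} {X : Set H} {d : ℕ → X} (hd : DenseRange d)
    (hv1 : ∀ n, ‖v n‖ ≤ 1)
    (hv : ∀ i, Tendsto (fun n => inner ℝ (v n) (d i : H)) atTop (𝓝 0)) (z : X) :
    Tendsto (fun n => inner ℝ (v n) (z : H)) atTop (𝓝 0) := by
  rw [Metric.tendsto_atTop]
  intro ε hε
  obtain ⟨i, hi⟩ := hd.exists_dist_lt z (half_pos hε)
  obtain ⟨M, hM⟩ := Metric.tendsto_atTop.1 (hv i) (ε / 2) (half_pos hε)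
  refine ⟨M, fun n hn => ?_⟩
  have h1 : |inner ℝ (v n) ((z : H) - d i)| < ε / 2 := by
    refine ((abs_real_inner_le_norm _ _).trans
      (mul_le_of_le_one_left (norm_nonneg _) (hv1 n))).trans_lt ?_
    rwa [← dist_eq_norm]
  have h2 := hM n hn
  rw [Real.dist_0_eq_abs] at h2 ⊢
  rw [inner_sub_right] at h1
  calc |inner ℝ (v n) (z : H)|
      = |(inner ℝ (v n) (z : H) - inner ℝ (v n) (d i : H)) + inner ℝ (v n) (d i : H)| := by
        rw [sub_add_cancel]
    _ ≤ _ := abs_add_le _ _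
    _ < ε := by linarith

lemma lipschitzWith_inner_coe {X : Set H} (h : H) :
    LipschitzWith ‖h‖₊ fun p : X => (inner ℝ (p : H) h : ℝ) :=
  LipschitzWith.of_dist_le_mul fun p q => by
    rw [Real.dist_eq, ← inner_sub_left, mul_comm, Subtype.dist_eq, dist_eq_norm]
    exact abs_real_inner_le_norm _ _

/-- Near a diagonal point, finitely many inner products together with the distance to that point
separate pairs. -/
lemma SeparatedOn.exists_mem_nhds_diagonal [MeasurableSpace H] [BorelSpace H]
    {X : Set H} (hX : IsCompact X) (μ : Measure X) [IsFiniteMeasure μ]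
    {a : ℝ} (ha : 0 < a)
    (hlow : ∀ x y : X, a * ‖(x : H) - (y : H)‖ ≤
      Real.sqrt (∫ z : X, (‖(x : H) - (z : H)‖ - ‖(y : H) - (z : H)‖) ^ 2 ∂μ)) (x : X) :
    ∃ U ∈ 𝓝 (x, x), SeparatedOn U := by
  by_contra! hcon
  have : CompactSpace X := isCompact_iff_compactSpace.1 hX
  have : Nonempty X := ⟨x⟩
  let d : ℕ → X := TopologicalSpace.denseSeq X
  let δ : ℕ → ℝ := fun n => 1 / ((n : ℝ) + 1)
  have hδ0 : Tendsto δ atTop (𝓝 0) := tendsto_one_div_add_atTop_nhds_zero_nat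
  have hδ (n) : 0 < δ n := Nat.one_div_pos_of_nat
  have hbad (n : ℕ) : ∃ p q : X, dist p x < δ n ∧ dist q x < δ n ∧
      |dist p x - dist q x| < δ n * dist p q ∧
      ∀ i ≤ n, |inner ℝ (p : H) (d i : H) - inner ℝ (q : H) (d i : H)| < δ n * dist p q := by
    by_contra! hno
    refine hcon _ (prod_mem_nhds (Metric.ball_mem_nhds x (hδ n)) (Metric.ball_mem_nhds x (hδ n)))
      ⟨insert (fun p => dist p x) ((fun i (p : X) => inner ℝ (p : H) (d i : H)) '' Set.Iic n),
        ((Set.finite_Iic n).image _).insert _, ?_, δ n, hδ n, ?_⟩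
    · rintro g (rfl | ⟨i, -, rfl⟩)
      exacts [⟨1, LipschitzWith.dist_left x⟩, ⟨_, lipschitzWith_inner_coe _⟩]
    · rintro ⟨p, q⟩ ⟨hp, hq⟩
      by_cases h : |dist p x - dist q x| < δ n * dist p q
      · obtain ⟨i, hi, hle⟩ := hno p q hp hq h
        exact ⟨_, Or.inr ⟨i, hi, rfl⟩, hle⟩
      · exact ⟨_, Or.inl rfl, not_lt.1 h⟩
  choose p q hp hq hx hd using hbad
  have hpos (n) : 0 < ‖(p n : H) - q n‖ := by
    have h := (abs_nonneg _).trans_lt (hx n)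
    rw [Subtype.dist_eq (p n) (q n), dist_eq_norm] at h
    exact pos_of_mul_pos_right h (hδ n).le
  have hplim : Tendsto (fun n => (p n : H)) atTop (𝓝 x) :=
    tendsto_iff_dist_tendsto_zero.2 (squeeze_zero (fun _ => dist_nonneg) (fun n => (hp n).le) hδ0)
  have hqlim : Tendsto (fun n => (q n : H)) atTop (𝓝 x) :=
    tendsto_iff_dist_tendsto_zero.2 (squeeze_zero (fun _ => dist_nonneg) (fun n => (hq n).le) hδ0)
  set v : ℕ → H := fun n => ‖(p n : H) - q n‖⁻¹ • ((p n : H) - q n) with hvdef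
  have hv1 (n) : ‖v n‖ ≤ 1 := by
    simp only [hvdef, norm_smul, norm_inv, norm_norm]
    exact inv_mul_le_one
  have hvd (i) : Tendsto (fun n => inner ℝ (v n) (d i : H)) atTop (𝓝 0) := by
    refine squeeze_zero_norm' ?_ hδ0
    filter_upwards [eventually_ge_atTop i] with n hn
    have h := hd n i hn
    rw [← inner_sub_left, Subtype.dist_eq, dist_eq_norm] at h
    simp only [hvdef, inner_smul_left, conj_trivial, Real.norm_eq_abs, abs_mul, abs_inv, abs_norm]
    rw [inv_mul_le_iff₀ (hpos n), mul_comm]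
    exact h.le
  have hvz := tendsto_inner_of_denseRange (TopologicalSpace.denseRange_denseSeq X) hv1 hvd
  have hlim (z : X) : Tendsto
      (fun n => ((‖(p n : H) - z‖ - ‖(q n : H) - z‖) / ‖(p n : H) - q n‖) ^ 2) atTop (𝓝 0) := by
    rw [← zero_pow two_ne_zero]
    refine Tendsto.pow ?_ 2
    by_cases hzx : z = x
    · subst hzx
      refine squeeze_zero_norm (fun n => ?_) hδ0
      have h := (hx n).le
      simp only [Subtype.dist_eq, dist_eq_norm] at h
      rw [norm_div, norm_norm, Real.norm_eq_abs]
      exact (div_le_iff₀ (hpos n)).2 h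
    · refine tendsto_norm_sub_sub_norm_sub_div (fun h => hzx (Subtype.ext h)) hplim hqlim ?_
      simpa only [inner_sub_right, sub_zero] using (hvz x).sub (hvz z)
  have hint : Tendsto (fun n => ∫ z : X,
      ((‖(p n : H) - z‖ - ‖(q n : H) - z‖) / ‖(p n : H) - q n‖) ^ 2 ∂μ) atTop (𝓝 0) := by
    have := tendsto_integral_of_dominated_convergence (μ := μ)
      (F := fun n (z : X) => ((‖(p n : H) - z‖ - ‖(q n : H) - z‖) / ‖(p n : H) - q n‖) ^ 2)
      (f := fun _ => 0) (fun _ => 1) (fun n => ?_) (integrable_const 1) (fun n => ?_)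
      (Eventually.of_forall hlim)
    · simpa using this
    · exact Continuous.aestronglyMeasurable (by fun_prop)
    · refine Eventually.of_forall fun z => ?_
      rw [norm_pow, norm_div, norm_norm, Real.norm_eq_abs]
      refine pow_le_one₀ (by positivity) ((div_le_one (hpos n)).2 ?_)
      simpa using abs_norm_sub_norm_le ((p n : H) - z) ((q n : H) - z)
  have hge (n) : a ^ 2 ≤ ∫ z : X,
      ((‖(p n : H) - z‖ - ‖(q n : H) - z‖) / ‖(p n : H) - q n‖) ^ 2 ∂μ := by
    simp only [div_pow]
    rw [integral_div, le_div_iff₀ (pow_pos (hpos n) 2), ← mul_pow]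
    exact (Real.le_sqrt' (mul_pos ha (hpos n))).1 (hlow (p n) (q n))
  exact absurd (ge_of_tendsto' hint hge) (not_le.2 (by positivity))

end InnerProductSpace

/-- **Proposition `inhil`.** Let `X` be a compact subset of a real
Hilbert space `H` with the inherited metric and `μ` a finite Borel regular measure on
`X` with closed support `X`, `0 < μ(X) < ∞`.  Assume `(X, d)` is Kał-doubling.  If the
canonical map `ι_d : X → L²(μ)`, `x ↦ (z ↦ ‖x − z‖)`, is bi-Lipschitz, then `X` admits
a bi-Lipschitz embedding into some `ℝ^N`. -/
theorem biLipschitz_embedding_of_kal_doubling_hilbert_subset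
    {H : Type*} [NormedAddCommGroup H] [InnerProductSpace ℝ H] [CompleteSpace H]
    [MeasurableSpace H] [BorelSpace H]
    (X : Set H) (hX : IsCompact X)
    (μ : Measure X) [IsFiniteMeasure μ] [μ.Regular] [μ.IsOpenPosMeasure]
    (hμ : μ Set.univ ≠ 0)
    (hkal : KalDoubling X)
    (a b : ℝ) (ha : 0 < a) (hab : a ≤ b)
    (hbl : ∀ x y : X,
      a * ‖(x : H) - (y : H)‖ ≤
          Real.sqrt (∫ z : X, (‖(x : H) - (z : H)‖ - ‖(y : H) - (z : H)‖) ^ 2 ∂μ) ∧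
      Real.sqrt (∫ z : X, (‖(x : H) - (z : H)‖ - ‖(y : H) - (z : H)‖) ^ 2 ∂μ) ≤
          b * ‖(x : H) - (y : H)‖) :
    ∃ (N : ℕ) (f : X → EuclideanSpace ℝ (Fin N)) (c e : ℝ), 0 < c ∧ c ≤ e ∧
      ∀ x y : X,
        c * ‖(x : H) - (y : H)‖ ≤ dist (f x) (f y) ∧
        dist (f x) (f y) ≤ e * ‖(x : H) - (y : H)‖ := by
  have : CompactSpace X := isCompact_iff_compactSpace.1 hX
  simp only [← dist_eq_norm, ← Subtype.dist_eq]
  refine (SeparatedOn.univ_of_forall_nhds fun p => ?_).exists_biLipschitz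
  obtain ⟨x, y⟩ := p
  rcases eq_or_ne x y with rfl | hxy
  · exact SeparatedOn.exists_mem_nhds_diagonal hX μ ha (fun x y => (hbl x y).1) x
  · exact SeparatedOn.exists_mem_nhds_of_dist_pos (dist_pos.2 hxy)
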